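/- For the finite Laumon fixed points, the matrix coefficient formula e_{i[d,d']} = -ℏ^{-1}·∏_{j≠k≤i}(x_j - x_k + (d_{ik}-d_{ij})ℏ)^{-1}·∏_{k≤i-1}(x_j - x_k + (d_{i-1,k}-d_{ij})ℏ) (when d'_{ij} = d_{ij}+1) and f_{i[d,d']} = ℏ^{-1}·∏_{j≠k≤i}(x_k - x_j + (d_{ij}-d_{ik})ℏ)^{-1}·∏_{k≤i+1}(x_k - x_j + (d_{ij}-d_{i+1,k})ℏ) (when d'_{ij} = d_{ij}-1) define operators e_i, f_i, together with diagonal h_i = ℏ^{-1}(x_{i+1}-x_i) + 2d_i - d_{i-1} - d_{i+1} + 1, satisfying the sl_2-triple relations [e_i, f_i] = -h_i (up to sign convention: [f_i, e_i] = h_i) and [h_i, e_i] = 2e_i, [h_i, f_i] = -2f_i on the span of the basis vectors indexed by Gelfand–Tsetlin collections. -/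

import Mathlib

set_option synthInstance.maxHeartbeats 1000000
set_option maxHeartbeats 1000000

/-- The field `ℂ(x_1, …, x_n, ℏ)` (realized with countably many generic variables:
`ℏ` is the variable `0` and `x_j` is the variable `j`). -/
abbrev LaumonField : Type := FractionRing (MvPolynomial ℕ ℂ)

noncomputable def xv (j : ℕ) : LaumonField :=
  algebraMap (MvPolynomial ℕ ℂ) LaumonField (MvPolynomial.X j)

noncomputable def hbarv : LaumonField :=
  algebraMap (MvPolynomial ℕ ℂ) LaumonField (MvPolynomial.X 0)

/-- Gelfand–Tsetlin collections `(d_{kj})_{n-1 ≥ k ≥ j ≥ 1}` of nonnegative integers with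
`d_{mj} ≥ d_{kj}` for `k ≥ m ≥ j`, normalized to vanish outside the triangular region
(in particular `d_{n,j} = 0`). -/
def FinPattern (n : ℕ) :=
  {d : ℕ → ℕ → ℕ //
    (∀ i j : ℕ, (i = 0 ∨ j = 0 ∨ n - 1 < i ∨ i < j) → d i j = 0) ∧
    (∀ i k j : ℕ, 1 ≤ j → j ≤ k → k ≤ i → i ≤ n - 1 → d i j ≤ d k j)}

noncomputable instance : Field LaumonField := inferInstance

set_option synthInstance.maxHeartbeats 1000000 in
noncomputable instance (n : ℕ) : AddCommGroup (FinPattern n →₀ LaumonField) := inferInstance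

set_option synthInstance.maxHeartbeats 1000000 in
noncomputable instance (n : ℕ) : Module LaumonField (FinPattern n →₀ LaumonField) :=
  inferInstance

/-- Row degrees `d_k = ∑_{j≤k} d_{kj}`. -/
noncomputable def rowSum {n : ℕ} (d : FinPattern n) (k : ℕ) : LaumonField :=
  (↑(∑ j ∈ Finset.Icc 1 k, d.1 k j) : LaumonField)

/-- Matrix coefficient of `e_i` (when `d'_{ij} = d_{ij} + 1`):
`-ℏ^{-1} ∏_{j≠k≤i}(x_j - x_k + (d_{ik}-d_{ij})ℏ)^{-1} ∏_{k≤i-1}(x_j - x_k + (d_{i-1,k}-d_{ij})ℏ)`. -/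
noncomputable def eCoeff (i : ℕ) (d : ℕ → ℕ → ℕ) (j : ℕ) : LaumonField :=
  -hbarv⁻¹ *
    (∏ k ∈ (Finset.Icc 1 i).erase j,
      (xv j - xv k + (((d i k : ℤ) - (d i j : ℤ) : ℤ) : LaumonField) * hbarv))⁻¹ *
    ∏ k ∈ Finset.Icc 1 (i - 1),
      (xv j - xv k + (((d (i-1) k : ℤ) - (d i j : ℤ) : ℤ) : LaumonField) * hbarv)

/-- Matrix coefficient of `f_i` (when `d'_{ij} = d_{ij} - 1`):
`ℏ^{-1} ∏_{j≠k≤i}(x_k - x_j + (d_{ij}-d_{ik})ℏ)^{-1} ∏_{k≤i+1}(x_k - x_j + (d_{ij}-d_{i+1,k})ℏ)`. -/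
noncomputable def fCoeff (i : ℕ) (d : ℕ → ℕ → ℕ) (j : ℕ) : LaumonField :=
  hbarv⁻¹ *
    (∏ k ∈ (Finset.Icc 1 i).erase j,
      (xv k - xv j + (((d i j : ℤ) - (d i k : ℤ) : ℤ) : LaumonField) * hbarv))⁻¹ *
    ∏ k ∈ Finset.Icc 1 (i + 1),
      (xv k - xv j + (((d i j : ℤ) - (d (i+1) k : ℤ) : ℤ) : LaumonField) * hbarv)

lemma lsl_sum_res {K ι κ : Type*} [Field K] [DecidableEq ι] (S : Finset ι) (z : ι → K)
    (hz : Set.InjOn z S) (R : Finset κ) (r : κ → K) (hc : R.card = S.card) (hp : 0 < S.card) :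
    ∑ a ∈ S, (∏ b ∈ R, (z a - r b)) / ∏ b ∈ S.erase a, (z a - z b)
      = ∑ a ∈ S, z a - ∑ b ∈ R, r b := by
  classical
  have hdeg : (Lagrange.nodal R r - Lagrange.nodal S z).degree < S.card := by
    have h1 : (Lagrange.nodal R r).degree = (S.card : WithBot ℕ) := by
      rw [Lagrange.degree_nodal, hc]
    have h2 : (Lagrange.nodal S z).degree = (S.card : WithBot ℕ) := Lagrange.degree_nodal
    rw [← h1]
    exact Polynomial.degree_sub_lt_left (h1.trans h2.symm) Lagrange.nodal_ne_zero
      (by rw [Lagrange.nodal_monic.leadingCoeff, Lagrange.nodal_monic.leadingCoeff])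
  have h := Lagrange.coeff_eq_sum hz hdeg
  rw [Polynomial.coeff_sub] at h
  nth_rewrite 1 [← hc] at h
  rw [Lagrange.nodal_eq, Lagrange.nodal_eq,
    Polynomial.prod_X_sub_C_coeff_card_pred R r (hc ▸ hp),
    Polynomial.prod_X_sub_C_coeff_card_pred S z hp] at h
  have h' : ∑ a ∈ S, z a - ∑ b ∈ R, r b = -∑ b ∈ R, r b - -∑ a ∈ S, z a := by ring
  rw [h', h]
  refine Finset.sum_congr rfl fun a ha => ?_
  congr 1
  rw [Polynomial.eval_sub, ← Lagrange.nodal_eq, ← Lagrange.nodal_eq,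
    Lagrange.eval_nodal_at_node ha, sub_zero, Lagrange.eval_nodal]

lemma lsl_prod_neg {K κ : Type*} [Field K] (R : Finset κ) (a b : κ → K) :
    ∏ k ∈ R, (a k - b k) = (-1) ^ R.card * ∏ k ∈ R, (b k - a k) := by
  rw [← Finset.prod_const, ← Finset.prod_mul_distrib]
  exact Finset.prod_congr rfl fun k _ => by ring

lemma lsl_key {K : Type*} [Field K] (S T U : Finset ℕ) (hS : 0 < S.card)
    (hU : U.card = S.card + 1) (hT : T.card + 1 = S.card)
    (u v w : ℕ → K) (hb : K) (hb0 : hb ≠ 0)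
    (h0 : ∀ j ∈ S, ∀ k ∈ S, j ≠ k → u j - u k ≠ 0)
    (h1 : ∀ j ∈ S, ∀ k ∈ S, j ≠ k → u j + hb - u k ≠ 0) :
    ∑ j ∈ S, ((hb⁻¹ * (∏ k ∈ S.erase j, (u k - u j))⁻¹ * ∏ k ∈ U, (v k - u j)) *
        (-hb⁻¹ * (∏ k ∈ S.erase j, (u j + hb - u k))⁻¹ * ∏ k ∈ T, (u j + hb - w k))
      - (-hb⁻¹ * (∏ k ∈ S.erase j, (u j - u k))⁻¹ * ∏ k ∈ T, (u j - w k)) *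
        (hb⁻¹ * (∏ k ∈ S.erase j, (u k - (u j - hb)))⁻¹ * ∏ k ∈ U, (v k - (u j - hb))))
    = hb⁻¹ * (∑ k ∈ T, w k + ∑ k ∈ U, v k - 2 * ∑ k ∈ S, u k + hb) := by
  have hz : Set.InjOn (Sum.elim u (fun j => u j + hb)) (S.disjSum S : Finset (ℕ ⊕ ℕ)) := by
    rintro (a | a) ha (b | b) hbm hab <;>
      simp only [Finset.mem_coe, Finset.inl_mem_disjSum, Finset.inr_mem_disjSum, Sum.elim_inl,
        Sum.elim_inr] at ha hbm hab
    · by_contra hne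
      exact h0 a ha b hbm (fun h => hne (by rw [h])) (by rw [hab]; ring)
    · by_cases hne : a = b
      · subst hne
        exact absurd (by linear_combination -hab) hb0
      · exact absurd (by linear_combination -hab) (h1 b hbm a ha (Ne.symm hne))
    · by_cases hne : a = b
      · subst hne
        exact absurd (by linear_combination hab) hb0
      · exact absurd (by linear_combination hab) (h1 a ha b hbm hne)
    · by_contra hne
      exact h0 a ha b hbm (fun h => hne (by rw [h])) (by linear_combination hab)
  have key := lsl_sum_res (S.disjSum S) (Sum.elim u (fun j => u j + hb)) hz (T.disjSum U)
    (Sum.elim w (fun j => v j + hb)) (by rw [Finset.card_disjSum, Finset.card_disjSum]; omega)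
    (by rw [Finset.card_disjSum]; omega)
  have e1 : ∀ j, (S.disjSum S).erase (Sum.inl j) = (S.erase j).disjSum S := by
    intro j; ext (a | a) <;> simp
  have e2 : ∀ j, (S.disjSum S).erase (Sum.inr j) = S.disjSum (S.erase j) := by
    intro j; ext (a | a) <;> simp
  simp only [Finset.sum_disjSum, Finset.prod_disjSum, Sum.elim_inl, Sum.elim_inr, e1, e2,
    Finset.sum_add_distrib, Finset.sum_const, nsmul_eq_mul, hU] at key
  have key2 : hb⁻¹ * (∑ k ∈ T, w k + ∑ k ∈ U, v k - 2 * ∑ k ∈ S, u k + hb) =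
      -hb⁻¹ * (∑ k ∈ S, u k + (∑ k ∈ S, u k + (S.card : K) * hb) -
        (∑ k ∈ T, w k + (∑ k ∈ U, v k + ((S.card + 1 : ℕ) : K) * hb))) := by
    push_cast; ring
  rw [key2, ← key, ← Finset.sum_add_distrib, Finset.mul_sum]
  refine Finset.sum_congr rfl fun j hj => ?_
  have hc1 : (S.erase j).card = T.card := by rw [Finset.card_erase_of_mem hj]; omega
  have n1 : ∏ k ∈ S.erase j, (u j - u k) ≠ 0 := Finset.prod_ne_zero_iff.2 fun k hk =>
    h0 j hj k (Finset.mem_of_mem_erase hk) (Finset.ne_of_mem_erase hk).symm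
  have n2 : ∏ k ∈ S.erase j, (u j + hb - u k) ≠ 0 := Finset.prod_ne_zero_iff.2 fun k hk =>
    h1 j hj k (Finset.mem_of_mem_erase hk) (Finset.ne_of_mem_erase hk).symm
  have n3 : ∏ k ∈ S.erase j, (u j - (u k + hb)) ≠ 0 := Finset.prod_ne_zero_iff.2 fun k hk => by
    have := h1 k (Finset.mem_of_mem_erase hk) j hj (Finset.ne_of_mem_erase hk)
    intro h; apply this; linear_combination -h
  have p1 : ∏ k ∈ S.erase j, (u k - u j) = (-1) ^ T.card * ∏ k ∈ S.erase j, (u j - u k) := by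
    rw [lsl_prod_neg, hc1]
  have p2 : ∏ k ∈ S.erase j, (u k - (u j - hb))
      = (-1) ^ T.card * ∏ k ∈ S.erase j, (u j - (u k + hb)) := by
    rw [lsl_prod_neg, hc1]; congr 1; exact Finset.prod_congr rfl fun k _ => by ring
  have hUT : U.card = T.card + 2 := by omega
  have p3 : ∏ k ∈ U, (v k - u j) = (-1) ^ T.card * ∏ k ∈ U, (u j + hb - (v k + hb)) := by
    rw [lsl_prod_neg, hUT, pow_add]; simp
  have p4 : ∏ k ∈ U, (v k - (u j - hb)) = (-1) ^ T.card * ∏ k ∈ U, (u j - (v k + hb)) := by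
    rw [lsl_prod_neg, hUT, pow_add]
    simp only [even_two, Even.neg_pow, one_pow, mul_one]
    congr 1; exact Finset.prod_congr rfl fun k _ => by ring
  have q1 : ∏ k ∈ S, (u j - (u k + hb)) = -hb * ∏ k ∈ S.erase j, (u j - (u k + hb)) := by
    rw [← Finset.mul_prod_erase S _ hj]; ring
  have q2 : ∏ k ∈ S, (u j + hb - u k) = hb * ∏ k ∈ S.erase j, (u j + hb - u k) := by
    rw [← Finset.mul_prod_erase S _ hj]; ring
  have q3 : ∏ k ∈ S.erase j, (u j + hb - (u k + hb)) = ∏ k ∈ S.erase j, (u j - u k) :=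
    Finset.prod_congr rfl fun k _ => by ring
  rw [p1, p2, p3, p4, q1, q2, q3]
  have hs : ((-1 : K) ^ T.card) ≠ 0 := pow_ne_zero _ (by simp)
  generalize (-1 : K) ^ T.card = s at *
  generalize ∏ k ∈ S.erase j, (u j - u k) = a at *
  generalize ∏ k ∈ S.erase j, (u j + hb - u k) = b at *
  generalize ∏ k ∈ S.erase j, (u j - (u k + hb)) = c at *
  field_simp
  ring

/-- The predicate defining patterns. -/
def LslPat (n : ℕ) (d : ℕ → ℕ → ℕ) : Prop :=
  (∀ i j : ℕ, (i = 0 ∨ j = 0 ∨ n - 1 < i ∨ i < j) → d i j = 0) ∧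
    (∀ i k j : ℕ, 1 ≤ j → j ≤ k → k ≤ i → i ≤ n - 1 → d i j ≤ d k j)

/-- Replace one entry. -/
def lslSet (d : ℕ → ℕ → ℕ) (i j m : ℕ) : ℕ → ℕ → ℕ :=
  fun a b => if a = i ∧ b = j then m else d a b

lemma lslSet_self (d : ℕ → ℕ → ℕ) (i j m : ℕ) : lslSet d i j m i j = m := by simp [lslSet]

lemma lslSet_ne (d : ℕ → ℕ → ℕ) (i j m a b : ℕ) (h : ¬(a = i ∧ b = j)) :
    lslSet d i j m a b = d a b := by simp [lslSet, h]

open Classical in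
/-- Replace one entry of a pattern if this gives a pattern. -/
noncomputable def lslMod {n : ℕ} (d : FinPattern n) (i j m : ℕ) : FinPattern n :=
  if h : LslPat n (lslSet d.1 i j m) then ⟨lslSet d.1 i j m, h⟩ else d

lemma lslMod_val {n : ℕ} (d : FinPattern n) (i j m : ℕ) (h : LslPat n (lslSet d.1 i j m)) :
    (lslMod d i j m).1 = lslSet d.1 i j m := by
  simp [lslMod, h]

/-- Condition under which entry `(i,j)` can be raised. -/
def LslUp (d : ℕ → ℕ → ℕ) (i j : ℕ) : Prop := j = i ∨ d i j < d (i - 1) j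

/-- Condition under which entry `(i,j)` can be lowered. -/
def LslDn (d : ℕ → ℕ → ℕ) (i j : ℕ) : Prop := d (i + 1) j < d i j

lemma lsl_up_pat {n : ℕ} (d : FinPattern n) (i j : ℕ) (hi2 : i ≤ n - 1)
    (hj1 : 1 ≤ j) (hj2 : j ≤ i) (h : LslUp d.1 i j) : LslPat n (lslSet d.1 i j (d.1 i j + 1)) := by
  obtain ⟨d, hd1, hd2⟩ := d
  simp only [LslUp] at h
  refine ⟨fun a b hab => ?_, fun a k b hb hbk hka han => ?_⟩
  · rw [lslSet_ne _ _ _ _ _ _ (by omega)]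
    exact hd1 a b hab
  · have := hd2 a k b hb hbk hka han
    simp only [lslSet]
    split_ifs with c1 c2 c2
    · exact le_rfl
    · obtain ⟨rfl, rfl⟩ := c1
      have hk : k ≤ a - 1 := by omega
      have h3 := hd2 (a - 1) k b hb hbk hk (by omega)
      omega
    · obtain ⟨rfl, rfl⟩ := c2
      omega
    · exact this

lemma lsl_dn_pat {n : ℕ} (d : FinPattern n) (i j : ℕ) (hi2 : i ≤ n - 1)
    (hj1 : 1 ≤ j) (hj2 : j ≤ i) (h : LslDn d.1 i j) : LslPat n (lslSet d.1 i j (d.1 i j - 1)) := by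
  obtain ⟨d, hd1, hd2⟩ := d
  simp only [LslDn] at h
  refine ⟨fun a b hab => ?_, fun a k b hb hbk hka han => ?_⟩
  · rw [lslSet_ne _ _ _ _ _ _ (by omega)]
    exact hd1 a b hab
  · have := hd2 a k b hb hbk hka han
    simp only [lslSet]
    split_ifs with c1 c2 c2
    · exact le_rfl
    · obtain ⟨rfl, rfl⟩ := c1
      omega
    · obtain ⟨rfl, rfl⟩ := c2
      have h3 := hd2 a (k + 1) b hb (by omega) (by omega) han
      omega
    · exact this

/-- If the entry cannot be lowered it equals the one below. -/
lemma lsl_not_dn {n : ℕ} (d : FinPattern n) (i j : ℕ) (hi2 : i ≤ n - 1)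
    (hj1 : 1 ≤ j) (hj2 : j ≤ i) (h : ¬ LslDn d.1 i j) : d.1 i j = d.1 (i + 1) j := by
  obtain ⟨d, hd1, hd2⟩ := d
  simp only [LslDn] at h ⊢
  by_cases hn : i + 1 ≤ n - 1
  · have := hd2 (i + 1) i j hj1 hj2 (by omega) hn
    omega
  · have := hd1 (i + 1) j (by omega)
    omega

lemma lsl_not_up {n : ℕ} (d : FinPattern n) (i j : ℕ) (hi2 : i ≤ n - 1)
    (hj1 : 1 ≤ j) (hj2 : j ≤ i) (h : ¬ LslUp d.1 i j) :
    j ≤ i - 1 ∧ d.1 i j = d.1 (i - 1) j := by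
  obtain ⟨d, hd1, hd2⟩ := d
  simp only [LslUp, not_or] at h ⊢
  have := hd2 i (i - 1) j hj1 (by omega) (by omega) hi2
  omega

section generic
variable {K : Type*} [Field K]

/-- Shifted variables. -/
def lslX (x : ℕ → K) (hb : K) (d : ℕ → ℕ → ℕ) (a k : ℕ) : K := x k - (d a k : K) * hb

/-- Generic coefficient of `e_i`. -/
noncomputable def lslE (x : ℕ → K) (hb : K) (i : ℕ) (d : ℕ → ℕ → ℕ) (j : ℕ) : K :=
  -hb⁻¹ * (∏ k ∈ (Finset.Icc 1 i).erase j, (lslX x hb d i j - lslX x hb d i k))⁻¹ *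
    ∏ k ∈ Finset.Icc 1 (i - 1), (lslX x hb d i j - lslX x hb d (i - 1) k)

/-- Generic coefficient of `f_i`. -/
noncomputable def lslF (x : ℕ → K) (hb : K) (i : ℕ) (d : ℕ → ℕ → ℕ) (j : ℕ) : K :=
  hb⁻¹ * (∏ k ∈ (Finset.Icc 1 i).erase j, (lslX x hb d i k - lslX x hb d i j))⁻¹ *
    ∏ k ∈ Finset.Icc 1 (i + 1), (lslX x hb d (i + 1) k - lslX x hb d i j)

/-- Generic eigenvalue of `h_i`. -/
noncomputable def lslH (x : ℕ → K) (hb : K) (i : ℕ) (d : ℕ → ℕ → ℕ) : K :=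
  hb⁻¹ * (x (i + 1) - x i) + 2 * ((∑ j ∈ Finset.Icc 1 i, d i j : ℕ) : K)
    - ((∑ j ∈ Finset.Icc 1 (i - 1), d (i - 1) j : ℕ) : K)
    - ((∑ j ∈ Finset.Icc 1 (i + 1), d (i + 1) j : ℕ) : K) + 1

lemma lslE_zero (x : ℕ → K) (hb : K) (i : ℕ) (d : ℕ → ℕ → ℕ) (j : ℕ) (hj1 : 1 ≤ j)
    (hj2 : j ≤ i - 1) (h : d i j = d (i - 1) j) : lslE x hb i d j = 0 := by
  rw [lslE, Finset.prod_eq_zero (i := j) (s := Finset.Icc 1 (i - 1)), mul_zero]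
  · simp [hj1, hj2]
  · simp [lslX, h]

lemma lslF_zero (x : ℕ → K) (hb : K) (i : ℕ) (d : ℕ → ℕ → ℕ) (j : ℕ) (hj1 : 1 ≤ j)
    (hj2 : j ≤ i) (h : d i j = d (i + 1) j) : lslF x hb i d j = 0 := by
  rw [lslF, Finset.prod_eq_zero (i := j) (s := Finset.Icc 1 (i + 1)), mul_zero]
  · simp; omega
  · simp [lslX, h]

lemma lsl_off_coeff (x : ℕ → K) (hb : K) (i : ℕ) (d : ℕ → ℕ → ℕ) (j l : ℕ) (hjl : j ≠ l)
    (hi : 1 ≤ i) (hj : j ∈ Finset.Icc 1 i) (hl : l ∈ Finset.Icc 1 i) (hd : 1 ≤ d i l) :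
    lslF x hb i d l * lslE x hb i (lslSet d i l (d i l - 1)) j
      = lslE x hb i d j * lslF x hb i (lslSet d i j (d i j + 1)) l := by
  have hl' : l ∈ (Finset.Icc 1 i).erase j := Finset.mem_erase.2 ⟨hjl.symm, hl⟩
  have hj' : j ∈ (Finset.Icc 1 i).erase l := Finset.mem_erase.2 ⟨hjl, hj⟩
  have a1 : ∀ k, lslX x hb (lslSet d i l (d i l - 1)) (i - 1) k = lslX x hb d (i - 1) k := by
    intro k; rw [lslX, lslX, lslSet_ne _ _ _ _ _ _ (by omega)]
  have a2 : ∀ k, k ≠ l → lslX x hb (lslSet d i l (d i l - 1)) i k = lslX x hb d i k := by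
    intro k hk; rw [lslX, lslX, lslSet_ne _ _ _ _ _ _ (by omega)]
  have a3 : lslX x hb (lslSet d i l (d i l - 1)) i l = lslX x hb d i l + hb := by
    rw [lslX, lslX, lslSet_self, Nat.cast_sub hd]; push_cast; ring
  have b1 : ∀ k, lslX x hb (lslSet d i j (d i j + 1)) (i + 1) k = lslX x hb d (i + 1) k := by
    intro k; rw [lslX, lslX, lslSet_ne _ _ _ _ _ _ (by omega)]
  have b2 : ∀ k, k ≠ j → lslX x hb (lslSet d i j (d i j + 1)) i k = lslX x hb d i k := by
    intro k hk; rw [lslX, lslX, lslSet_ne _ _ _ _ _ _ (by omega)]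
  have b3 : lslX x hb (lslSet d i j (d i j + 1)) i j = lslX x hb d i j - hb := by
    rw [lslX, lslX, lslSet_self]; push_cast; ring
  simp only [lslE, lslF, a1, b1]
  rw [a2 j hjl, b2 l hjl.symm]
  rw [← Finset.mul_prod_erase _ _ hl', ← Finset.mul_prod_erase _ _ hj',
    ← Finset.mul_prod_erase _ _ hl', ← Finset.mul_prod_erase _ _ hj', a3, b3]
  have c1 : ∏ k ∈ ((Finset.Icc 1 i).erase j).erase l,
      (lslX x hb d i j - lslX x hb (lslSet d i l (d i l - 1)) i k)
      = ∏ k ∈ ((Finset.Icc 1 i).erase j).erase l, (lslX x hb d i j - lslX x hb d i k) :=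
    Finset.prod_congr rfl fun k hk => by rw [a2 k (Finset.ne_of_mem_erase hk)]
  have c2 : ∏ k ∈ ((Finset.Icc 1 i).erase l).erase j,
      (lslX x hb (lslSet d i j (d i j + 1)) i k - lslX x hb d i l)
      = ∏ k ∈ ((Finset.Icc 1 i).erase l).erase j, (lslX x hb d i k - lslX x hb d i l) :=
    Finset.prod_congr rfl fun k hk => by rw [b2 k (Finset.ne_of_mem_erase hk)]
  rw [c1, c2]
  have e : lslX x hb d i j - (lslX x hb d i l + hb) = lslX x hb d i j - hb - lslX x hb d i l := by
    ring
  rw [e]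
  simp only [mul_inv]
  ring

/-- Diagonal coefficient of `e f`. -/
noncomputable def lslA (x : ℕ → K) (hb : K) (i : ℕ) (d : ℕ → ℕ → ℕ) (j : ℕ) : K :=
  (hb⁻¹ * (∏ k ∈ (Finset.Icc 1 i).erase j, (lslX x hb d i k - lslX x hb d i j))⁻¹ *
      ∏ k ∈ Finset.Icc 1 (i + 1), (lslX x hb d (i + 1) k - lslX x hb d i j)) *
    (-hb⁻¹ * (∏ k ∈ (Finset.Icc 1 i).erase j, (lslX x hb d i j + hb - lslX x hb d i k))⁻¹ *
      ∏ k ∈ Finset.Icc 1 (i - 1), (lslX x hb d i j + hb - lslX x hb d (i - 1) k))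

/-- Diagonal coefficient of `f e`. -/
noncomputable def lslB (x : ℕ → K) (hb : K) (i : ℕ) (d : ℕ → ℕ → ℕ) (j : ℕ) : K :=
  (-hb⁻¹ * (∏ k ∈ (Finset.Icc 1 i).erase j, (lslX x hb d i j - lslX x hb d i k))⁻¹ *
      ∏ k ∈ Finset.Icc 1 (i - 1), (lslX x hb d i j - lslX x hb d (i - 1) k)) *
    (hb⁻¹ * (∏ k ∈ (Finset.Icc 1 i).erase j, (lslX x hb d i k - (lslX x hb d i j - hb)))⁻¹ *
      ∏ k ∈ Finset.Icc 1 (i + 1), (lslX x hb d (i + 1) k - (lslX x hb d i j - hb)))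

lemma lsl_diag_A (x : ℕ → K) (hb : K) (i : ℕ) (d : ℕ → ℕ → ℕ) (j : ℕ)
    (hi : 1 ≤ i) (hd : 1 ≤ d i j) :
    lslF x hb i d j * lslE x hb i (lslSet d i j (d i j - 1)) j = lslA x hb i d j := by
  have a1 : ∀ k, lslX x hb (lslSet d i j (d i j - 1)) (i - 1) k = lslX x hb d (i - 1) k := by
    intro k; rw [lslX, lslX, lslSet_ne _ _ _ _ _ _ (by omega)]
  have a3 : lslX x hb (lslSet d i j (d i j - 1)) i j = lslX x hb d i j + hb := by
    rw [lslX, lslX, lslSet_self, Nat.cast_sub hd]; push_cast; ring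
  rw [lslF, lslE, lslA]
  simp only [a1, a3]
  congr 4
  refine Finset.prod_congr rfl fun k hk => ?_
  rw [lslX, lslX, lslX, lslSet_ne _ _ _ _ _ _ (by have := Finset.ne_of_mem_erase hk; omega)]

lemma lsl_diag_B (x : ℕ → K) (hb : K) (i : ℕ) (d : ℕ → ℕ → ℕ) (j : ℕ) :
    lslE x hb i d j * lslF x hb i (lslSet d i j (d i j + 1)) j = lslB x hb i d j := by
  have a1 : ∀ k, lslX x hb (lslSet d i j (d i j + 1)) (i + 1) k = lslX x hb d (i + 1) k := by
    intro k; rw [lslX, lslX, lslSet_ne _ _ _ _ _ _ (by omega)]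
  have a3 : lslX x hb (lslSet d i j (d i j + 1)) i j = lslX x hb d i j - hb := by
    rw [lslX, lslX, lslSet_self]; push_cast; ring
  rw [lslF, lslE, lslB]
  simp only [a1, a3]
  congr 4
  refine Finset.prod_congr rfl fun k hk => ?_
  rw [lslX, lslX, lslX, lslSet_ne _ _ _ _ _ _ (by have := Finset.ne_of_mem_erase hk; omega)]

lemma lsl_diag_sum (x : ℕ → K) (hb : K) (hb0 : hb ≠ 0)
    (hx : ∀ j k : ℕ, 1 ≤ j → 1 ≤ k → j ≠ k → ∀ m : ℤ, x j - x k + (m : K) * hb ≠ 0)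
    (i : ℕ) (d : ℕ → ℕ → ℕ) (hi : 1 ≤ i) :
    ∑ j ∈ Finset.Icc 1 i, (lslA x hb i d j - lslB x hb i d j) = lslH x hb i d := by
  have key := lsl_key (Finset.Icc 1 i) (Finset.Icc 1 (i - 1)) (Finset.Icc 1 (i + 1))
    (by simp; omega) (by simp) (by simp; omega)
    (lslX x hb d i) (lslX x hb d (i + 1)) (lslX x hb d (i - 1)) hb hb0
    (by
      intro j hj k hk hjk
      rw [Finset.mem_Icc] at hj hk
      have := hx j k hj.1 hk.1 hjk ((d i k : ℤ) - d i j)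
      intro h; apply this; rw [← h]; simp only [lslX]; push_cast; ring)
    (by
      intro j hj k hk hjk
      rw [Finset.mem_Icc] at hj hk
      have := hx j k hj.1 hk.1 hjk ((d i k : ℤ) - d i j + 1)
      intro h; apply this; rw [← h]; simp only [lslX]; push_cast; ring)
  refine Eq.trans key ?_
  obtain ⟨m, rfl⟩ : ∃ m, i = m + 1 := ⟨i - 1, by omega⟩
  simp only [lslX, Finset.sum_sub_distrib, lslH, ← Finset.sum_mul, Nat.add_sub_cancel]
  have s1 : ∑ k ∈ Finset.Icc 1 (m + 1), x k = ∑ k ∈ Finset.Icc 1 m, x k + x (m + 1) :=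
    Finset.sum_Icc_succ_top (by omega) _
  have s2 : ∑ k ∈ Finset.Icc 1 (m + 1 + 1), x k
      = ∑ k ∈ Finset.Icc 1 m, x k + x (m + 1) + x (m + 1 + 1) := by
    rw [Finset.sum_Icc_succ_top (by omega), s1]
  rw [s2, s1]
  push_cast
  field_simp
  ring

lemma lsl_H_up (x : ℕ → K) (hb : K) (i : ℕ) (d : ℕ → ℕ → ℕ) (hi : 1 ≤ i) (j : ℕ)
    (hj : j ∈ Finset.Icc 1 i) :
    lslH x hb i (lslSet d i j (d i j + 1)) = lslH x hb i d + 2 := by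
  have r1 : ∑ k ∈ Finset.Icc 1 i, lslSet d i j (d i j + 1) i k
      = ∑ k ∈ Finset.Icc 1 i, d i k + 1 := by
    rw [← Finset.add_sum_erase _ _ hj, ← Finset.add_sum_erase _ _ hj, lslSet_self]
    have q : ∑ k ∈ (Finset.Icc 1 i).erase j, lslSet d i j (d i j + 1) i k
        = ∑ k ∈ (Finset.Icc 1 i).erase j, d i k :=
      Finset.sum_congr rfl fun k hk => lslSet_ne d i j (d i j + 1) i k
        (by have := Finset.ne_of_mem_erase hk; omega)
    rw [q]
    omega
  have r2 : ∀ a, a ≠ i → ∀ k, lslSet d i j (d i j + 1) a k = d a k := fun a ha k =>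
    lslSet_ne _ _ _ _ _ _ (by omega)
  simp only [lslH]
  rw [r1]
  simp only [r2 (i - 1) (by omega), r2 (i + 1) (by omega)]
  push_cast
  ring

lemma lsl_H_dn (x : ℕ → K) (hb : K) (i : ℕ) (d : ℕ → ℕ → ℕ) (hi : 1 ≤ i) (j : ℕ)
    (hj : j ∈ Finset.Icc 1 i) (hd : 1 ≤ d i j) :
    lslH x hb i (lslSet d i j (d i j - 1)) = lslH x hb i d - 2 := by
  have r1 : ∑ k ∈ Finset.Icc 1 i, d i k
      = ∑ k ∈ Finset.Icc 1 i, lslSet d i j (d i j - 1) i k + 1 := by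
    rw [← Finset.add_sum_erase _ _ hj, ← Finset.add_sum_erase _ _ hj, lslSet_self]
    have q : ∑ k ∈ (Finset.Icc 1 i).erase j, lslSet d i j (d i j - 1) i k
        = ∑ k ∈ (Finset.Icc 1 i).erase j, d i k :=
      Finset.sum_congr rfl fun k hk => lslSet_ne d i j (d i j - 1) i k
        (by have := Finset.ne_of_mem_erase hk; omega)
    rw [q]
    omega
  have r2 : ∀ a, a ≠ i → ∀ k, lslSet d i j (d i j - 1) a k = d a k := fun a ha k =>
    lslSet_ne _ _ _ _ _ _ (by omega)
  simp only [lslH]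
  rw [r1]
  simp only [r2 (i - 1) (by omega), r2 (i + 1) (by omega)]
  push_cast
  ring

lemma lsl_E_apply (n i : ℕ) (hi2 : i ≤ n - 1) (x : ℕ → K) (hb : K)
    (d : FinPattern n) (g : FinPattern n →₀ K)
    (hE1 : ∀ (d' : FinPattern n) (j : ℕ), 1 ≤ j → j ≤ i →
      d'.1 i j = d.1 i j + 1 → (∀ a b : ℕ, ¬(a = i ∧ b = j) → d'.1 a b = d.1 a b) →
      g d' = lslE x hb i d.1 j)
    (hE0 : ∀ d' : FinPattern n,
      (¬∃ j : ℕ, 1 ≤ j ∧ j ≤ i ∧ d'.1 i j = d.1 i j + 1 ∧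
        ∀ a b : ℕ, ¬(a = i ∧ b = j) → d'.1 a b = d.1 a b) → g d' = 0) :
    g = ∑ j ∈ Finset.Icc 1 i, lslE x hb i d.1 j •
      Finsupp.single (lslMod d i j (d.1 i j + 1)) (1 : K) := by
  classical
  have hz : ∀ j ∈ Finset.Icc 1 i, ¬ LslUp d.1 i j → lslE x hb i d.1 j = 0 := by
    intro j hj h
    rw [Finset.mem_Icc] at hj
    obtain ⟨h1, h2⟩ := lsl_not_up d i j hi2 hj.1 hj.2 h
    exact lslE_zero _ _ _ _ _ hj.1 h1 h2
  ext d'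
  rw [Finsupp.finsetSum_apply]
  simp only [Finsupp.smul_apply, Finsupp.single_apply, smul_eq_mul]
  by_cases hex : ∃ j : ℕ, 1 ≤ j ∧ j ≤ i ∧ d'.1 i j = d.1 i j + 1 ∧
        ∀ a b : ℕ, ¬(a = i ∧ b = j) → d'.1 a b = d.1 a b
  · obtain ⟨j, hj1, hj2, hj3, hj4⟩ := hex
    have hj : j ∈ Finset.Icc 1 i := Finset.mem_Icc.2 ⟨hj1, hj2⟩
    rw [hE1 d' j hj1 hj2 hj3 hj4, Finset.sum_eq_single_of_mem j hj]
    · by_cases hu : LslUp d.1 i j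
      · rw [if_pos, mul_one]
        apply Subtype.ext
        rw [lslMod_val _ _ _ _ (lsl_up_pat d i j hi2 hj1 hj2 hu)]
        funext a b
        by_cases hab : a = i ∧ b = j
        · obtain ⟨rfl, rfl⟩ := hab
          rw [lslSet_self, hj3]
        · rw [lslSet_ne _ _ _ _ _ _ hab, hj4 a b hab]
      · rw [hz j hj hu, zero_mul]
    · intro k hk hkj
      by_cases hu : LslUp d.1 i k
      · rw [if_neg, mul_zero]
        intro h
        have hk' := Finset.mem_Icc.1 hk
        have h5 := congrArg (fun p : FinPattern n => p.1 i k) h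
        simp only [lslMod_val _ _ _ _ (lsl_up_pat d i k hi2 hk'.1 hk'.2 hu), lslSet_self] at h5
        have := hj4 i k (by omega)
        omega
      · rw [hz k hk hu, zero_mul]
  · rw [hE0 d' hex]
    symm
    refine Finset.sum_eq_zero fun k hk => ?_
    by_cases hu : LslUp d.1 i k
    · rw [if_neg, mul_zero]
      rintro rfl
      have hk' := Finset.mem_Icc.1 hk
      have hv := lslMod_val _ _ _ _ (lsl_up_pat d i k hi2 hk'.1 hk'.2 hu)
      exact hex ⟨k, hk'.1, hk'.2, by rw [hv, lslSet_self],
        fun a b hab => by rw [hv, lslSet_ne _ _ _ _ _ _ hab]⟩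
    · rw [hz k hk hu, zero_mul]

lemma lsl_F_apply (n i : ℕ) (hi2 : i ≤ n - 1) (x : ℕ → K) (hb : K)
    (d : FinPattern n) (g : FinPattern n →₀ K)
    (hF1 : ∀ (d' : FinPattern n) (j : ℕ), 1 ≤ j → j ≤ i →
      d'.1 i j + 1 = d.1 i j → (∀ a b : ℕ, ¬(a = i ∧ b = j) → d'.1 a b = d.1 a b) →
      g d' = lslF x hb i d.1 j)
    (hF0 : ∀ d' : FinPattern n,
      (¬∃ j : ℕ, 1 ≤ j ∧ j ≤ i ∧ d'.1 i j + 1 = d.1 i j ∧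
        ∀ a b : ℕ, ¬(a = i ∧ b = j) → d'.1 a b = d.1 a b) → g d' = 0) :
    g = ∑ j ∈ Finset.Icc 1 i, lslF x hb i d.1 j •
      Finsupp.single (lslMod d i j (d.1 i j - 1)) (1 : K) := by
  classical
  have hz : ∀ j ∈ Finset.Icc 1 i, ¬ LslDn d.1 i j → lslF x hb i d.1 j = 0 := by
    intro j hj h
    rw [Finset.mem_Icc] at hj
    exact lslF_zero _ _ _ _ _ hj.1 hj.2 (lsl_not_dn d i j hi2 hj.1 hj.2 h)
  ext d'
  rw [Finsupp.finsetSum_apply]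
  simp only [Finsupp.smul_apply, Finsupp.single_apply, smul_eq_mul]
  by_cases hex : ∃ j : ℕ, 1 ≤ j ∧ j ≤ i ∧ d'.1 i j + 1 = d.1 i j ∧
        ∀ a b : ℕ, ¬(a = i ∧ b = j) → d'.1 a b = d.1 a b
  · obtain ⟨j, hj1, hj2, hj3, hj4⟩ := hex
    have hj : j ∈ Finset.Icc 1 i := Finset.mem_Icc.2 ⟨hj1, hj2⟩
    rw [hF1 d' j hj1 hj2 hj3 hj4, Finset.sum_eq_single_of_mem j hj]
    · by_cases hu : LslDn d.1 i j
      · rw [if_pos, mul_one]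
        apply Subtype.ext
        rw [lslMod_val _ _ _ _ (lsl_dn_pat d i j hi2 hj1 hj2 hu)]
        funext a b
        by_cases hab : a = i ∧ b = j
        · obtain ⟨rfl, rfl⟩ := hab
          rw [lslSet_self]; omega
        · rw [lslSet_ne _ _ _ _ _ _ hab, hj4 a b hab]
      · rw [hz j hj hu, zero_mul]
    · intro k hk hkj
      by_cases hu : LslDn d.1 i k
      · rw [if_neg, mul_zero]
        intro h
        have hk' := Finset.mem_Icc.1 hk
        have h5 := congrArg (fun p : FinPattern n => p.1 i k) h
        simp only [lslMod_val _ _ _ _ (lsl_dn_pat d i k hi2 hk'.1 hk'.2 hu), lslSet_self] at h5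
        have := hj4 i k (by omega)
        simp only [LslDn] at hu
        omega
      · rw [hz k hk hu, zero_mul]
  · rw [hF0 d' hex]
    symm
    refine Finset.sum_eq_zero fun k hk => ?_
    by_cases hu : LslDn d.1 i k
    · rw [if_neg, mul_zero]
      rintro rfl
      have hk' := Finset.mem_Icc.1 hk
      have hv := lslMod_val _ _ _ _ (lsl_dn_pat d i k hi2 hk'.1 hk'.2 hu)
      exact hex ⟨k, hk'.1, hk'.2, by rw [hv, lslSet_self]; simp only [LslDn] at hu; omega,
        fun a b hab => by rw [hv, lslSet_ne _ _ _ _ _ _ hab]⟩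
    · rw [hz k hk hu, zero_mul]

lemma lsl_off (n i : ℕ) (hi1 : 1 ≤ i) (hi2 : i ≤ n - 1) (x : ℕ → K) (hb : K)
    (d : FinPattern n) (j l : ℕ) (hjl : j ≠ l) (hj : j ∈ Finset.Icc 1 i)
    (hl : l ∈ Finset.Icc 1 i) :
    (lslF x hb i d.1 l * lslE x hb i (lslMod d i l (d.1 i l - 1)).1 j) •
      Finsupp.single (lslMod (lslMod d i l (d.1 i l - 1)) i j
        ((lslMod d i l (d.1 i l - 1)).1 i j + 1)) (1 : K)
    = (lslE x hb i d.1 j * lslF x hb i (lslMod d i j (d.1 i j + 1)).1 l) •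
      Finsupp.single (lslMod (lslMod d i j (d.1 i j + 1)) i l
        ((lslMod d i j (d.1 i j + 1)).1 i l - 1)) (1 : K) := by
  have hj' := Finset.mem_Icc.1 hj
  have hl' := Finset.mem_Icc.1 hl
  -- entries away from the modified one do not change
  have hm : ∀ (b m a c : ℕ), ¬(a = i ∧ c = b) → (lslMod d i b m).1 a c = d.1 a c := by
    intro b m a c h
    by_cases hp : LslPat n (lslSet d.1 i b m)
    · rw [lslMod_val _ _ _ _ hp, lslSet_ne _ _ _ _ _ _ h]
    · simp [lslMod, hp]
  by_cases hD : LslDn d.1 i l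
  · by_cases hU : LslUp d.1 i j
    · have pD := lsl_dn_pat d i l hi2 hl'.1 hl'.2 hD
      have pU := lsl_up_pat d i j hi2 hj'.1 hj'.2 hU
      have vD := lslMod_val _ _ _ _ pD
      have vU := lslMod_val _ _ _ _ pU
      have hU' : LslUp (lslMod d i l (d.1 i l - 1)).1 i j := by
        simp only [LslUp] at hU ⊢
        rw [hm _ _ _ _ (by omega), hm _ _ _ _ (by omega)]
        exact hU
      have hD' : LslDn (lslMod d i j (d.1 i j + 1)).1 i l := by
        simp only [LslDn] at hD ⊢
        rw [hm _ _ _ _ (by omega), hm _ _ _ _ (by omega)]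
        exact hD
      have wU := lslMod_val _ _ _ _ (lsl_up_pat _ i j hi2 hj'.1 hj'.2 hU')
      have wD := lslMod_val _ _ _ _ (lsl_dn_pat _ i l hi2 hl'.1 hl'.2 hD')
      have hpat : lslMod (lslMod d i l (d.1 i l - 1)) i j
            ((lslMod d i l (d.1 i l - 1)).1 i j + 1)
          = lslMod (lslMod d i j (d.1 i j + 1)) i l
            ((lslMod d i j (d.1 i j + 1)).1 i l - 1) := by
        apply Subtype.ext
        rw [wU, wD, hm l _ i j (by omega), hm j _ i l (by omega), vD, vU]
        funext a b
        simp only [lslSet]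
        split_ifs <;> first | rfl | omega
      rw [hpat, vD, vU, lsl_off_coeff x hb i d.1 j l hjl hi1 hj hl
        (by simp only [LslDn] at hD; omega)]
    · obtain ⟨h1, h2⟩ := lsl_not_up d i j hi2 hj'.1 hj'.2 hU
      rw [lslE_zero x hb i d.1 j hj'.1 h1 h2, lslE_zero x hb i (lslMod d i l _).1 j hj'.1 h1
        (by rw [hm _ _ _ _ (by omega), hm _ _ _ _ (by omega)]; exact h2)]
      simp
  · have h2 := lsl_not_dn d i l hi2 hl'.1 hl'.2 hD
    rw [lslF_zero x hb i d.1 l hl'.1 hl'.2 h2, lslF_zero x hb i (lslMod d i j _).1 l hl'.1 hl'.2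
      (by rw [hm _ _ _ _ (by omega), hm _ _ _ _ (by omega)]; exact h2)]
    simp

lemma lsl_on_A (n i : ℕ) (hi1 : 1 ≤ i) (hi2 : i ≤ n - 1) (x : ℕ → K) (hb : K)
    (d : FinPattern n) (j : ℕ) (hj : j ∈ Finset.Icc 1 i) :
    (lslF x hb i d.1 j * lslE x hb i (lslMod d i j (d.1 i j - 1)).1 j) •
      Finsupp.single (lslMod (lslMod d i j (d.1 i j - 1)) i j
        ((lslMod d i j (d.1 i j - 1)).1 i j + 1)) (1 : K)
    = lslA x hb i d.1 j • Finsupp.single d (1 : K) := by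
  have hj' := Finset.mem_Icc.1 hj
  by_cases hD : LslDn d.1 i j
  · have vD := lslMod_val _ _ _ _ (lsl_dn_pat d i j hi2 hj'.1 hj'.2 hD)
    have h1 : 1 ≤ d.1 i j := by simp only [LslDn] at hD; omega
    have hs : lslSet (lslMod d i j (d.1 i j - 1)).1 i j
        ((lslMod d i j (d.1 i j - 1)).1 i j + 1) = d.1 := by
      rw [vD, lslSet_self]
      funext a b
      by_cases h : a = i ∧ b = j
      · obtain ⟨rfl, rfl⟩ := h
        rw [lslSet_self]; omega
      · rw [lslSet_ne _ _ _ _ _ _ h, lslSet_ne _ _ _ _ _ _ h]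
    have hp : lslMod (lslMod d i j (d.1 i j - 1)) i j
        ((lslMod d i j (d.1 i j - 1)).1 i j + 1) = d := by
      apply Subtype.ext
      rw [lslMod_val, hs]
      rw [hs]; exact d.2
    rw [hp, vD, lsl_diag_A x hb i d.1 j hi1 h1]
  · have h0 := lslF_zero x hb i d.1 j hj'.1 hj'.2 (lsl_not_dn d i j hi2 hj'.1 hj'.2 hD)
    have hA : lslA x hb i d.1 j = 0 := by
      rw [lslF] at h0
      rw [lslA, h0, zero_mul]
    rw [h0, hA]
    simp

lemma lsl_on_B (n i : ℕ) (hi2 : i ≤ n - 1) (x : ℕ → K) (hb : K)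
    (d : FinPattern n) (j : ℕ) (hj : j ∈ Finset.Icc 1 i) :
    (lslE x hb i d.1 j * lslF x hb i (lslMod d i j (d.1 i j + 1)).1 j) •
      Finsupp.single (lslMod (lslMod d i j (d.1 i j + 1)) i j
        ((lslMod d i j (d.1 i j + 1)).1 i j - 1)) (1 : K)
    = lslB x hb i d.1 j • Finsupp.single d (1 : K) := by
  have hj' := Finset.mem_Icc.1 hj
  by_cases hU : LslUp d.1 i j
  · have vU := lslMod_val _ _ _ _ (lsl_up_pat d i j hi2 hj'.1 hj'.2 hU)
    have hs : lslSet (lslMod d i j (d.1 i j + 1)).1 i j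
        ((lslMod d i j (d.1 i j + 1)).1 i j - 1) = d.1 := by
      rw [vU, lslSet_self]
      funext a b
      by_cases h : a = i ∧ b = j
      · obtain ⟨rfl, rfl⟩ := h
        rw [lslSet_self]; omega
      · rw [lslSet_ne _ _ _ _ _ _ h, lslSet_ne _ _ _ _ _ _ h]
    have hp : lslMod (lslMod d i j (d.1 i j + 1)) i j
        ((lslMod d i j (d.1 i j + 1)).1 i j - 1) = d := by
      apply Subtype.ext
      rw [lslMod_val, hs]
      rw [hs]; exact d.2
    rw [hp, vU, lsl_diag_B x hb i d.1 j]
  · obtain ⟨h1, h2⟩ := lsl_not_up d i j hi2 hj'.1 hj'.2 hU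
    have h0 := lslE_zero x hb i d.1 j hj'.1 h1 h2
    have hB : lslB x hb i d.1 j = 0 := by
      rw [lslE] at h0
      rw [lslB, h0, zero_mul]
    rw [h0, hB]
    simp

theorem lsl_core (n : ℕ) (i : ℕ) (hi1 : 1 ≤ i) (hi2 : i ≤ n - 1) (x : ℕ → K) (hb : K)
    (hb0 : hb ≠ 0)
    (hx : ∀ j k : ℕ, 1 ≤ j → 1 ≤ k → j ≠ k → ∀ m : ℤ, x j - x k + (m : K) * hb ≠ 0)
    (E Fo H : (FinPattern n →₀ K) →ₗ[K] (FinPattern n →₀ K))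
    (hH : ∀ d : FinPattern n, H (Finsupp.single d 1) = lslH x hb i d.1 • Finsupp.single d 1)
    (hE : ∀ d : FinPattern n, E (Finsupp.single d 1) = ∑ j ∈ Finset.Icc 1 i,
      lslE x hb i d.1 j • Finsupp.single (lslMod d i j (d.1 i j + 1)) (1 : K))
    (hF : ∀ d : FinPattern n, Fo (Finsupp.single d 1) = ∑ j ∈ Finset.Icc 1 i,
      lslF x hb i d.1 j • Finsupp.single (lslMod d i j (d.1 i j - 1)) (1 : K)) :
    H ∘ₗ E - E ∘ₗ H = (2 : K) • E
    ∧ H ∘ₗ Fo - Fo ∘ₗ H = (-2 : K) • Fo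
    ∧ E ∘ₗ Fo - Fo ∘ₗ E = H := by
  refine ⟨?_, ?_, ?_⟩
  · refine Finsupp.lhom_ext' fun d => LinearMap.ext_ring ?_
    simp only [LinearMap.comp_apply, Finsupp.lsingle_apply, LinearMap.sub_apply,
      LinearMap.smul_apply, hE, hH, map_sum, map_smul, Finset.smul_sum]
    rw [← Finset.sum_sub_distrib]
    refine Finset.sum_congr rfl fun j hj => ?_
    have hj' := Finset.mem_Icc.1 hj
    by_cases hU : LslUp d.1 i j
    · rw [lslMod_val _ _ _ _ (lsl_up_pat d i j hi2 hj'.1 hj'.2 hU), lsl_H_up x hb i d.1 hi1 j hj,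
        smul_smul, smul_smul, smul_smul, ← sub_smul]
      congr 1; ring
    · obtain ⟨h1, h2⟩ := lsl_not_up d i j hi2 hj'.1 hj'.2 hU
      rw [lslE_zero x hb i d.1 j hj'.1 h1 h2]
      simp
  · refine Finsupp.lhom_ext' fun d => LinearMap.ext_ring ?_
    simp only [LinearMap.comp_apply, Finsupp.lsingle_apply, LinearMap.sub_apply,
      LinearMap.smul_apply, hF, hH, map_sum, map_smul, Finset.smul_sum]
    rw [← Finset.sum_sub_distrib]
    refine Finset.sum_congr rfl fun j hj => ?_
    have hj' := Finset.mem_Icc.1 hj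
    by_cases hD : LslDn d.1 i j
    · rw [lslMod_val _ _ _ _ (lsl_dn_pat d i j hi2 hj'.1 hj'.2 hD),
        lsl_H_dn x hb i d.1 hi1 j hj (by simp only [LslDn] at hD; omega),
        smul_smul, smul_smul, smul_smul, ← sub_smul]
      congr 1; ring
    · rw [lslF_zero x hb i d.1 j hj'.1 hj'.2 (lsl_not_dn d i j hi2 hj'.1 hj'.2 hD)]
      simp
  · refine Finsupp.lhom_ext' fun d => LinearMap.ext_ring ?_
    simp only [LinearMap.comp_apply, Finsupp.lsingle_apply, LinearMap.sub_apply,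
      hE, hF, hH, map_sum, map_smul, Finset.smul_sum, smul_smul]
    rw [Finset.sum_comm, ← Finset.sum_sub_distrib, ← lsl_diag_sum x hb hb0 hx i d.1 hi1,
      Finset.sum_smul]
    refine Finset.sum_congr rfl fun j hj => ?_
    rw [← Finset.sum_sub_distrib, Finset.sum_eq_single_of_mem j hj, lsl_on_A n i hi1 hi2 x hb d j hj,
      lsl_on_B n i hi2 x hb d j hj, sub_smul]
    intro l hl hlj
    rw [lsl_off n i hi1 hi2 x hb d j l hlj.symm hj hl, sub_self]

end generic

lemma lsl_hb_ne : hbarv ≠ 0 := by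
  unfold hbarv
  rw [Ne, IsFractionRing.to_map_eq_zero_iff]
  exact MvPolynomial.X_ne_zero 0

lemma lsl_x_ne (j k : ℕ) (hj : 1 ≤ j) (_hk : 1 ≤ k) (hjk : j ≠ k) (m : ℤ) :
    xv j - xv k + (m : LaumonField) * hbarv ≠ 0 := by
  have h : xv j - xv k + (m : LaumonField) * hbarv
      = algebraMap (MvPolynomial ℕ ℂ) LaumonField
        (MvPolynomial.X j - MvPolynomial.X k + (m : MvPolynomial ℕ ℂ) * MvPolynomial.X 0) := by
    simp only [xv, hbarv, map_add, map_sub, map_mul, map_intCast]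
  rw [h, Ne, IsFractionRing.to_map_eq_zero_iff]
  intro h0
  have h1 := congrArg (MvPolynomial.eval (fun t : ℕ => if t = j then (1 : ℂ) else 0)) h0
  have hj0 : ¬ (0 = j) := by omega
  simp [hjk.symm, hj0] at h1

lemma lsl_eCoeff (i : ℕ) (d : ℕ → ℕ → ℕ) (j : ℕ) :
    eCoeff i d j = lslE xv hbarv i d j := by
  unfold eCoeff lslE lslX
  congr 1
  · congr 2
    exact Finset.prod_congr rfl fun k _ => by push_cast; ring
  · exact Finset.prod_congr rfl fun k _ => by push_cast; ring

lemma lsl_fCoeff (i : ℕ) (d : ℕ → ℕ → ℕ) (j : ℕ) :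
    fCoeff i d j = lslF xv hbarv i d j := by
  unfold fCoeff lslF lslX
  congr 1
  · congr 2
    exact Finset.prod_congr rfl fun k _ => by push_cast; ring
  · exact Finset.prod_congr rfl fun k _ => by push_cast; ring

/-- the operators `e_i, f_i` defined by the explicit matrix coefficients in
the fixed point basis, together with the diagonal operator
`h_i = ℏ^{-1}(x_{i+1} - x_i) + 2d_i - d_{i-1} - d_{i+1} + 1`, satisfy the `sl_2`-triple
relations `[h_i, e_i] = 2e_i`, `[h_i, f_i] = -2f_i`, `[e_i, f_i] = h_i`. -/
theorem laumon_sl2_triple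
    (n : ℕ) (hn : 2 ≤ n) (i : ℕ) (hi1 : 1 ≤ i) (hi2 : i ≤ n - 1)
    (E Fo H : (FinPattern n →₀ LaumonField) →ₗ[LaumonField] (FinPattern n →₀ LaumonField))
    (hH : ∀ d : FinPattern n, H (Finsupp.single d 1)
      = (hbarv⁻¹ * (xv (i+1) - xv i) + 2 * rowSum d i - rowSum d (i-1) - rowSum d (i+1) + 1)
          • Finsupp.single d 1)
    (hE1 : ∀ (d d' : FinPattern n) (j : ℕ), 1 ≤ j → j ≤ i →
      d'.1 i j = d.1 i j + 1 → (∀ a b : ℕ, ¬(a = i ∧ b = j) → d'.1 a b = d.1 a b) →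
      (E (Finsupp.single d 1)) d' = eCoeff i d.1 j)
    (hE0 : ∀ d d' : FinPattern n,
      (¬∃ j : ℕ, 1 ≤ j ∧ j ≤ i ∧ d'.1 i j = d.1 i j + 1 ∧
        ∀ a b : ℕ, ¬(a = i ∧ b = j) → d'.1 a b = d.1 a b) →
      (E (Finsupp.single d 1)) d' = 0)
    (hF1 : ∀ (d d' : FinPattern n) (j : ℕ), 1 ≤ j → j ≤ i →
      d'.1 i j + 1 = d.1 i j → (∀ a b : ℕ, ¬(a = i ∧ b = j) → d'.1 a b = d.1 a b) →
      (Fo (Finsupp.single d 1)) d' = fCoeff i d.1 j)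
    (hF0 : ∀ d d' : FinPattern n,
      (¬∃ j : ℕ, 1 ≤ j ∧ j ≤ i ∧ d'.1 i j + 1 = d.1 i j ∧
        ∀ a b : ℕ, ¬(a = i ∧ b = j) → d'.1 a b = d.1 a b) →
      (Fo (Finsupp.single d 1)) d' = 0) :
    H ∘ₗ E - E ∘ₗ H = (2 : LaumonField) • E
    ∧ H ∘ₗ Fo - Fo ∘ₗ H = (-2 : LaumonField) • Fo
    ∧ E ∘ₗ Fo - Fo ∘ₗ E = H := by
  refine lsl_core n i hi1 hi2 xv hbarv lsl_hb_ne lsl_x_ne E Fo H (fun d => hH d) ?_ ?_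
  · intro d
    refine lsl_E_apply n i hi2 xv hbarv d _ ?_ (hE0 d)
    intro d' j h1 h2 h3 h4
    rw [← lsl_eCoeff]
    exact hE1 d d' j h1 h2 h3 h4
  · intro d
    refine lsl_F_apply n i hi2 xv hbarv d _ ?_ (hF0 d)
    intro d' j h1 h2 h3 h4
    rw [← lsl_fCoeff]
    exact hF1 d d' j h1 h2 h3 h4
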